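/- For every vector v in the ℝ-span of α1,…,α7 with ⟨v,γi⟩ ≥ 0 for all 1 ≤ i ≤ 6, there exists w ∈ W such that ⟨wρ,γi⟩ > 0 for all 1 ≤ i ≤ 6 and ⟨v, wαj⟩ ≥ 0 for all 1 ≤ j ≤ 7. (That is, the Δ⁺(k)-dominant cone is the union of the 56 Weyl chambers wC⁽⁰⁾ over those w ∈ W for which wρ is strictly Δ⁺(k)-dominant.) -/

import Mathlib

open scoped BigOperators

namespace E7

noncomputable section

/-- The standard inner product on ℝ⁸. -/
def ip (x y : Fin 8 → ℝ) : ℝ := ∑ i, x i * y i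

/-- The simple roots α₁,…,α₇ of E₇ (indexed by `Fin 7`). -/
def sroot : Fin 7 → Fin 8 → ℝ :=
  ![![1/2, -1/2, -1/2, -1/2, -1/2, -1/2, -1/2, 1/2],
    ![1, 1, 0, 0, 0, 0, 0, 0],
    ![-1, 1, 0, 0, 0, 0, 0, 0],
    ![0, -1, 1, 0, 0, 0, 0, 0],
    ![0, 0, -1, 1, 0, 0, 0, 0],
    ![0, 0, 0, -1, 1, 0, 0, 0],
    ![0, 0, 0, 0, -1, 1, 0, 0]]

/-- The root lattice `Q`: integer linear combinations of the simple roots. -/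
def latQ : Set (Fin 8 → ℝ) := {v | ∃ c : Fin 7 → ℤ, v = ∑ j, (c j : ℝ) • sroot j}

/-- The E₇ root system `Φ = {v ∈ Q : ⟨v,v⟩ = 2}`. -/
def Phi : Set (Fin 8 → ℝ) := {v | v ∈ latQ ∧ ip v v = 2}

/-- The vector ζ. -/
def zeta : Fin 8 → ℝ := ![0, 0, 0, 0, 0, 1, -1/2, 1/2]

/-- The positive roots Δ⁺: roots that are nonnegative integer combinations
of the simple roots. -/
def PhiPos : Set (Fin 8 → ℝ) :=
  {v | v ∈ Phi ∧ ∃ c : Fin 7 → ℕ, v = ∑ j, (c j : ℝ) • sroot j}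

/-- The compact positive roots Δ⁺(k) = {α ∈ Δ⁺ : ⟨α,ζ⟩ = 0}. -/
def PhiPosK : Set (Fin 8 → ℝ) := {v | v ∈ PhiPos ∧ ip v zeta = 0}

/-- The Weyl group `W` of E₇: the subgroup of linear automorphisms of ℝ⁸
generated by the reflections `s_α : v ↦ v − ⟨v,α⟩α` for `α ∈ Φ`. -/
def W : Subgroup ((Fin 8 → ℝ) ≃ₗ[ℝ] (Fin 8 → ℝ)) :=
  Subgroup.closure {g | ∃ a ∈ Phi, ∀ v, g v = v - ip v a • a}

/-- The subgroup of `W` generated by the six compact simple reflections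
`s_{γ₁},…,s_{γ₆}` (the Weyl group of E₆, i.e. of k). -/
def WK : Subgroup ((Fin 8 → ℝ) ≃ₗ[ℝ] (Fin 8 → ℝ)) :=
  Subgroup.closure
    {g | ∃ i : Fin 6, ∀ v, g v = v - ip v (sroot i.castSucc) • sroot i.castSucc}

end

lemma ip_eq_dotProduct (x y : Fin 8 → ℝ) : ip x y = x ⬝ᵥ y := rfl

lemma ip_comm (x y : Fin 8 → ℝ) : ip x y = ip y x := dotProduct_comm x y

/-- The integral combination of the simple roots with coefficients `c`. -/
noncomputable def comb (c : Fin 7 → ℤ) : Fin 8 → ℝ := ∑ j, (c j : ℝ) • sroot j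

/-- The bilinear form of the E₇ Cartan matrix on coefficient vectors. -/
def cartanForm (c d : Fin 7 → ℤ) : ℤ :=
  2 * ∑ i, c i * d i - (c 0 * d 2 + c 2 * d 0) - (c 2 * d 3 + c 3 * d 2) -
    (c 1 * d 3 + c 3 * d 1) - (c 3 * d 4 + c 4 * d 3) - (c 4 * d 5 + c 5 * d 4) -
    (c 5 * d 6 + c 6 * d 5)

lemma ip_comb (c d : Fin 7 → ℤ) : ip (comb c) (comb d) = cartanForm c d := by
  simp [ip, comb, cartanForm, sroot, Fin.sum_univ_succ]
  ring

lemma comb_sub (c d : Fin 7 → ℤ) : comb (c - d) = comb c - comb d := by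
  simp [comb, sub_smul]

lemma comb_zsmul (n : ℤ) (c : Fin 7 → ℤ) : comb (n • c) = (n : ℝ) • comb c := by
  simp [comb, mul_smul, Finset.smul_sum]

lemma comb_single (j : Fin 7) : comb (Pi.single j 1) = sroot j := by
  simp [comb, Pi.single_apply]

lemma comb_mem_latQ (c : Fin 7 → ℤ) : comb c ∈ latQ := ⟨c, rfl⟩

lemma ip_comb_right (r : Fin 8 → ℝ) (c : Fin 7 → ℤ) :
    ip r (comb c) = ∑ j, c j * ip r (sroot j) := by
  simp [ip_eq_dotProduct, comb, dotProduct_sum]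

lemma cartanForm_identity (c : Fin 7 → ℤ) :
    12 * cartanForm c c = 6 * (2 * c 1 - c 3) ^ 2 + 6 * (2 * c 0 - c 2) ^ 2 +
      2 * (3 * c 2 - 2 * c 3) ^ 2 + 6 * (2 * c 6 - c 5) ^ 2 + 2 * (3 * c 5 - 2 * c 4) ^ 2 +
      (4 * c 4 - 3 * c 3) ^ 2 + c 3 ^ 2 := by
  simp only [cartanForm, Fin.sum_univ_seven]
  ring

lemma even_cartanForm (c : Fin 7 → ℤ) : 2 ∣ cartanForm c c :=
  ⟨∑ i, c i * c i - c 0 * c 2 - c 2 * c 3 - c 1 * c 3 - c 3 * c 4 - c 4 * c 5 - c 5 * c 6, by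
    simp only [cartanForm]; ring⟩

lemma two_le_cartanForm {c : Fin 7 → ℤ} (hc : c ≠ 0) : 2 ≤ cartanForm c c := by
  have h := cartanForm_identity c
  suffices 0 < cartanForm c c by have := even_cartanForm c; omega
  by_contra! hle
  apply hc
  have h3 : c 3 = 0 := pow_eq_zero_iff two_ne_zero |>.1 (by nlinarith)
  have h1 : 2 * c 1 - c 3 = 0 := pow_eq_zero_iff two_ne_zero |>.1 (by nlinarith)
  have h0 : 2 * c 0 - c 2 = 0 := pow_eq_zero_iff two_ne_zero |>.1 (by nlinarith)
  have h2 : 3 * c 2 - 2 * c 3 = 0 := pow_eq_zero_iff two_ne_zero |>.1 (by nlinarith)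
  have h6 : 2 * c 6 - c 5 = 0 := pow_eq_zero_iff two_ne_zero |>.1 (by nlinarith)
  have h5 : 3 * c 5 - 2 * c 4 = 0 := pow_eq_zero_iff two_ne_zero |>.1 (by nlinarith)
  have h4 : 4 * c 4 - 3 * c 3 = 0 := pow_eq_zero_iff two_ne_zero |>.1 (by nlinarith)
  funext i
  fin_cases i <;> simp <;> omega

lemma cartanForm_nonpos_of_disjoint {p n : Fin 7 → ℤ} (hp : ∀ i, 0 ≤ p i) (hn : ∀ i, 0 ≤ n i)
    (h : ∀ i, p i * n i = 0) : cartanForm p n ≤ 0 := by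
  have hpn i j : 0 ≤ p i * n j := mul_nonneg (hp i) (hn j)
  simp only [cartanForm, h, Finset.sum_const_zero]
  linarith [hpn 0 2, hpn 2 0, hpn 2 3, hpn 3 2, hpn 1 3, hpn 3 1, hpn 3 4, hpn 4 3, hpn 4 5,
    hpn 5 4, hpn 5 6, hpn 6 5]

lemma cartanForm_sub_self (p n : Fin 7 → ℤ) :
    cartanForm (p - n) (p - n) = cartanForm p p + cartanForm n n - 2 * cartanForm p n := by
  simp only [cartanForm, Fin.sum_univ_seven, Pi.sub_apply]
  ring

/-- The coefficients of a root have a common sign. -/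
lemma nonneg_or_nonpos_of_cartanForm_eq_two {c : Fin 7 → ℤ} (hc : cartanForm c c = 2) :
    0 ≤ c ∨ c ≤ 0 := by
  have hsub : c⁺ - c⁻ = c := posPart_sub_negPart c
  have hdisj : ∀ i, c⁺ i * c⁻ i = 0 := fun i ↦ by
    rw [Pi.posPart_apply, Pi.negPart_apply]
    rcases le_total 0 (c i) with h | h <;> simp [h]
  have hle := cartanForm_nonpos_of_disjoint (posPart_nonneg c) (negPart_nonneg c) hdisj
  have hexp := cartanForm_sub_self c⁺ c⁻
  rw [hsub, hc] at hexp
  by_contra! h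
  have hp : c⁺ ≠ 0 := fun h0 ↦ h.2 (posPart_eq_zero.1 h0)
  have hn : c⁻ ≠ 0 := fun h0 ↦ h.1 (negPart_eq_zero.1 h0)
  linarith [two_le_cartanForm hp, two_le_cartanForm hn]

lemma exists_int_ip {x y : Fin 8 → ℝ} (hx : x ∈ latQ) (hy : y ∈ latQ) : ∃ n : ℤ, ip x y = n := by
  obtain ⟨c, rfl⟩ := hx
  obtain ⟨d, rfl⟩ := hy
  exact ⟨_, ip_comb c d⟩

lemma exists_comb_of_mem_Phi {a : Fin 8 → ℝ} (ha : a ∈ Phi) :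
    ∃ c, a = comb c ∧ cartanForm c c = 2 := by
  obtain ⟨⟨c, rfl⟩, h⟩ := ha
  have h2 := (ip_comb c c).symm.trans h
  exact ⟨c, rfl, by exact_mod_cast h2⟩

lemma mem_PhiPos_iff {x : Fin 8 → ℝ} :
    x ∈ PhiPos ↔ ∃ c : Fin 7 → ℤ, x = comb c ∧ cartanForm c c = 2 ∧ 0 ≤ c := by
  constructor
  · rintro ⟨⟨-, hx⟩, c, rfl⟩
    have hcomb : ∑ j, (c j : ℝ) • sroot j = comb (fun j ↦ c j) := by simp [comb]
    rw [hcomb, ip_comb] at hx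
    exact ⟨_, hcomb, by exact_mod_cast hx, fun j ↦ by simp⟩
  · rintro ⟨c, rfl, hc, h0⟩
    refine ⟨⟨comb_mem_latQ c, by rw [ip_comb, hc]; norm_num⟩, fun j ↦ (c j).toNat, ?_⟩
    refine Finset.sum_congr rfl fun j _ ↦ ?_
    rw [← Int.cast_natCast, Int.toNat_of_nonneg (h0 j)]

lemma ip_sroot_self (j : Fin 7) : ip (sroot j) (sroot j) = 2 := by
  fin_cases j <;> simp [ip, sroot, Fin.sum_univ_succ] <;> norm_num

lemma sroot_mem_Phi (j : Fin 7) : sroot j ∈ Phi :=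
  ⟨comb_single j ▸ comb_mem_latQ _, ip_sroot_self j⟩

lemma sroot_mem_PhiPos (j : Fin 7) : sroot j ∈ PhiPos := by
  refine mem_PhiPos_iff.2 ⟨Pi.single j 1, (comb_single j).symm, ?_, by simp⟩
  have := ip_comb (Pi.single j 1) (Pi.single j 1)
  rw [comb_single, ip_sroot_self] at this
  exact_mod_cast this.symm

/-- A nonnegative integral combination of simple roots is not the negative of a simple root. -/
lemma comb_ne_neg_sroot {c : Fin 7 → ℤ} (hc : 0 ≤ c) (j : Fin 7) : comb c ≠ -sroot j := by
  intro h
  set w : Fin 8 → ℝ := ![0, 1, 2, 3, 4, 5, -17/2, 17/2] with hw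
  have hone (i : Fin 7) : ip w (sroot i) = 1 := by
    fin_cases i <;> simp [hw, ip, sroot, Fin.sum_univ_succ] <;> norm_num
  have h1 : ip w (comb c) = -1 := by
    rw [h, ip_eq_dotProduct, dotProduct_neg, ← ip_eq_dotProduct, hone]
  rw [ip_comb_right] at h1
  have h2 : 0 ≤ ∑ i, (c i : ℝ) * ip w (sroot i) :=
    Finset.sum_nonneg fun i _ ↦ by rw [hone, mul_one]; exact_mod_cast hc i
  linarith

lemma ip_reflect {a : Fin 8 → ℝ} (ha : ip a a = 2) (x y : Fin 8 → ℝ) :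
    ip (x - ip x a • a) (y - ip y a • a) = ip x y := by
  simp only [ip_eq_dotProduct, sub_dotProduct, dotProduct_sub, smul_dotProduct, dotProduct_smul,
    smul_eq_mul] at *
  rw [ha, dotProduct_comm a y]
  ring

lemma ip_reflect_self {a : Fin 8 → ℝ} (ha : ip a a = 2) (x : Fin 8 → ℝ) :
    ip (x - ip x a • a) a = -ip x a := by
  simp only [ip_eq_dotProduct, sub_dotProduct, smul_dotProduct, smul_eq_mul] at *
  rw [ha]
  ring

lemma reflect_mem_latQ {a x : Fin 8 → ℝ} (ha : a ∈ latQ) (hx : x ∈ latQ) :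
    x - ip x a • a ∈ latQ := by
  obtain ⟨n, hn⟩ := exists_int_ip hx ha
  obtain ⟨c, rfl⟩ := hx
  obtain ⟨d, rfl⟩ := ha
  rw [hn]
  exact ⟨c - n • d, by rw [← comb, ← comb, ← comb, comb_sub, comb_zsmul]⟩

/-- A simple reflection permutes the positive roots other than its own simple root. -/
lemma reflect_mem_PhiPos {x : Fin 8 → ℝ} {j : Fin 7} (hx : x ∈ PhiPos) (hne : x ≠ sroot j) :
    x - ip x (sroot j) • sroot j ∈ PhiPos ∧ x - ip x (sroot j) • sroot j ≠ sroot j := by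
  obtain ⟨n, hn⟩ := exists_int_ip hx.1.1 (sroot_mem_Phi j).1
  have hnorm := ip_reflect (ip_sroot_self j) x x
  obtain ⟨c, rfl, hc, hc0⟩ := mem_PhiPos_iff.1 hx
  have hrefl := ip_reflect_self (ip_sroot_self j) (comb c)
  constructor
  · have heq : comb c - ip (comb c) (sroot j) • sroot j = comb (c - n • Pi.single j 1) := by
      rw [comb_sub, comb_zsmul, comb_single, hn]
    have hd : cartanForm (c - n • Pi.single j 1) (c - n • Pi.single j 1) = 2 := by
      rw [heq, ip_comb, ip_comb, hc] at hnorm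
      exact_mod_cast hnorm
    refine mem_PhiPos_iff.2 ⟨_, heq, hd, ?_⟩
    refine (nonneg_or_nonpos_of_cartanForm_eq_two hd).resolve_right fun hneg ↦ hne ?_
    have hz : ∀ i ≠ j, c i = 0 := fun i hi ↦ by
      have := hneg i
      simp [hi] at this
      exact le_antisymm this (hc0 i)
    have hcj : c = c j • Pi.single j 1 := by
      funext i
      by_cases hi : i = j
      · subst hi; simp
      · simp [hi, hz i hi]
    have hcomb : comb c = (c j : ℝ) • sroot j := by
      conv_lhs => rw [hcj, comb_zsmul, comb_single]
    have h1 : (c j : ℝ) * (c j * 2) = 2 := by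
      have := ip_comb c c
      rw [hc, hcomb, ip_eq_dotProduct, smul_dotProduct, dotProduct_smul, ← ip_eq_dotProduct,
        ip_sroot_self] at this
      simpa using this
    have h2 : (0 : ℝ) ≤ c j := by exact_mod_cast hc0 j
    have h3 : (c j : ℝ) = 1 := by nlinarith
    rw [hcomb, h3, one_smul]
  · intro h
    rw [h, ip_sroot_self] at hrefl
    have h2 : ip (comb c) (sroot j) = -2 := by linarith
    refine comb_ne_neg_sroot hc0 j ?_
    rw [h2] at h
    linear_combination (norm := module) h

lemma ip_sum_posRoots {sP : Finset (Fin 8 → ℝ)} (hsP : (sP : Set (Fin 8 → ℝ)) = PhiPos)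
    (j : Fin 7) : ip (∑ x ∈ sP, x) (sroot j) = 2 := by
  have hmem x : x ∈ sP ↔ x ∈ PhiPos := by rw [← hsP, Finset.mem_coe]
  rw [ip_eq_dotProduct, sum_dotProduct,
    ← Finset.add_sum_erase _ _ ((hmem _).2 (sroot_mem_PhiPos j)), ← ip_eq_dotProduct,
    ip_sroot_self, add_eq_left]
  refine Finset.sum_involution (fun x _ ↦ x - ip x (sroot j) • sroot j) ?_ ?_ ?_ ?_
  · intro x _
    rw [← ip_eq_dotProduct, ← ip_eq_dotProduct, ip_reflect_self (ip_sroot_self j), add_neg_cancel]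
  · intro x _ h0 heq
    have := ip_reflect_self (ip_sroot_self j) x
    rw [heq] at this
    exact h0 (by rw [← ip_eq_dotProduct]; linarith)
  · intro x hx
    rw [Finset.mem_erase, hmem] at hx ⊢
    exact (reflect_mem_PhiPos hx.2 hx.1).symm
  · intro x _
    simp only [ip_reflect_self (ip_sroot_self j), neg_smul, sub_neg_eq_add, sub_add_cancel]

lemma sum_posRoots_mem_latQ {sP : Finset (Fin 8 → ℝ)} (hsP : (sP : Set (Fin 8 → ℝ)) = PhiPos) :
    ∑ x ∈ sP, x ∈ latQ := by
  refine Finset.sum_induction _ (· ∈ latQ) ?_ ⟨0, by simp⟩ fun x hx ↦ ?_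
  · rintro _ _ ⟨c, rfl⟩ ⟨d, rfl⟩
    exact ⟨c + d, by simp [add_smul, Finset.sum_add_distrib]⟩
  · rw [← Finset.mem_coe, hsP] at hx
    exact hx.1.1

/-- The reflection in a root, as an element of `W`. -/
lemma exists_reflection_mem_W {a : Fin 8 → ℝ} (ha : a ∈ Phi) :
    ∃ s ∈ W, ∀ v, s v = v - ip v a • a := by
  let f : Module.Dual ℝ (Fin 8 → ℝ) := dotProductBilin ℝ ℝ a
  have hf v : f v = ip v a := by rw [ip_comm]; rfl
  have h2 : f a = 2 := (hf a).trans ha.2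
  have hs v : Module.reflection h2 v = v - ip v a • a := by rw [Module.reflection_apply, hf]
  exact ⟨_, Subgroup.subset_closure ⟨a, ha, hs⟩, hs⟩

lemma ip_map_map_of_mem_W {g : (Fin 8 → ℝ) ≃ₗ[ℝ] (Fin 8 → ℝ)} (hg : g ∈ W) (x y : Fin 8 → ℝ) :
    ip (g x) (g y) = ip x y := by
  induction hg using Subgroup.closure_induction generalizing x y with
  | mem g hg =>
    obtain ⟨a, ha, h⟩ := hg
    rw [h, h, ip_reflect ha.2]
  | one => rfl
  | mul g h _ _ ihg ihh => rw [LinearEquiv.mul_apply, LinearEquiv.mul_apply, ihg, ihh]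
  | inv g _ ih =>
    rw [← ih, ← LinearEquiv.mul_apply, ← LinearEquiv.mul_apply, mul_inv_cancel]
    rfl

lemma map_mem_latQ_of_mem_W {g : (Fin 8 → ℝ) ≃ₗ[ℝ] (Fin 8 → ℝ)} (hg : g ∈ W)
    {x : Fin 8 → ℝ} (hx : x ∈ latQ) : g x ∈ latQ := by
  induction hg using Subgroup.closure_induction'' generalizing x with
  | mem g hg =>
    obtain ⟨a, ha, h⟩ := hg
    exact h x ▸ reflect_mem_latQ ha.1 hx
  | inv_mem g hg =>
    obtain ⟨a, ha, h⟩ := hg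
    have : g⁻¹ x = x - ip x a • a := by
      change g.symm x = _
      rw [LinearEquiv.symm_apply_eq, h, ip_reflect_self ha.2]
      simp
    exact this ▸ reflect_mem_latQ ha.1 hx
  | one => exact hx
  | mul g h _ _ ihg ihh => exact ihg (ihh hx)

lemma exists_half_int_coord {x : Fin 8 → ℝ} (hx : x ∈ latQ) (i : Fin 8) :
    ∃ n : ℤ, x i = n / 2 := by
  obtain ⟨c, rfl⟩ := hx
  rw [Finset.sum_apply]
  refine Finset.sum_induction _ (fun y : ℝ ↦ ∃ n : ℤ, y = n / 2) ?_ ⟨0, by simp⟩ fun j _ ↦ ?_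
  · rintro _ _ ⟨m, rfl⟩ ⟨n, rfl⟩
    exact ⟨m + n, by push_cast; ring⟩
  · have h : ∃ n : ℤ, sroot j i = n / 2 := by
      suffices sroot j i = (-2 : ℤ) / 2 ∨ sroot j i = (-1 : ℤ) / 2 ∨ sroot j i = (0 : ℤ) / 2 ∨
          sroot j i = (1 : ℤ) / 2 ∨ sroot j i = (2 : ℤ) / 2 by
        rcases this with h | h | h | h | h <;> exact ⟨_, h⟩
      fin_cases j <;> fin_cases i <;> simp [sroot]
    obtain ⟨n, hn⟩ := h
    exact ⟨c j * n, by rw [Pi.smul_apply, hn, smul_eq_mul]; push_cast; ring⟩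

lemma finite_latQ_norm (M : ℝ) : {x | x ∈ latQ ∧ ip x x = M}.Finite := by
  set N : ℤ := ⌈4 * M⌉
  refine ((Set.finite_Icc (fun _ : Fin 8 ↦ -N) (fun _ ↦ N)).image
    (fun n i ↦ (n i : ℝ) / 2)).subset ?_
  rintro x ⟨hx, hM⟩
  choose n hn using exists_half_int_coord hx
  have hbound i : n i ^ 2 ≤ N := by
    have h1 : x i * x i ≤ M :=
      hM ▸ Finset.single_le_sum (f := fun i ↦ x i * x i) (fun i _ ↦ mul_self_nonneg (x i))
        (Finset.mem_univ i)
    have h2 : ((n i ^ 2 : ℤ) : ℝ) ≤ 4 * M := by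
      rw [hn] at h1
      push_cast
      linarith
    exact_mod_cast h2.trans (Int.le_ceil _)
  refine ⟨n, ⟨fun i ↦ ?_, fun i ↦ ?_⟩, (funext hn).symm⟩
  · have := hbound i
    change -N ≤ n i
    nlinarith [Int.le_self_sq (-n i)]
  · exact (Int.le_self_sq (n i)).trans (hbound i)

/-- A vector pairing positively with all simple roots is regular. -/
lemma ip_ne_zero_of_mem_Phi {r a : Fin 8 → ℝ} (hr : ∀ j, 0 < ip r (sroot j)) (ha : a ∈ Phi) :
    ip r a ≠ 0 := by
  obtain ⟨c, rfl, hc⟩ := exists_comb_of_mem_Phi ha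
  rw [ip_comb_right]
  intro h
  have key (d : Fin 7 → ℤ) (hd : 0 ≤ d) (hs : ∑ j, (d j : ℝ) * ip r (sroot j) = 0) : d = 0 := by
    rw [Finset.sum_eq_zero_iff_of_nonneg
      fun j _ ↦ mul_nonneg (Int.cast_nonneg (hd j)) (hr j).le] at hs
    funext j
    simpa [(hr j).ne'] using hs j (Finset.mem_univ j)
  have hc0 : c = 0 := by
    rcases nonneg_or_nonpos_of_cartanForm_eq_two hc with h0 | h0
    · exact key c h0 h
    · exact neg_eq_zero.1 (key (-c) (neg_nonneg.2 h0) (by simp [h]))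
  rw [hc0] at hc
  simp [cartanForm] at hc

/-- Among the `W`-translates of a regular dominant lattice vector `r`, the one maximizing first the
pairing with `v` and then the pairing with `r` lies in a chamber that contains `v`. -/
lemma exists_mem_W_dominant {r v : Fin 8 → ℝ} (hrQ : r ∈ latQ) (hr : ∀ j, 0 < ip r (sroot j))
    (hv : ∀ i : Fin 6, 0 ≤ ip v (sroot i.castSucc)) :
    ∃ g ∈ W, (∀ i : Fin 6, 0 < ip (g r) (sroot i.castSucc)) ∧
      ∀ j : Fin 7, 0 ≤ ip v (g (sroot j)) := by
  have hfin : ((fun g : (Fin 8 → ℝ) ≃ₗ[ℝ] (Fin 8 → ℝ) ↦ g r) '' W).Finite := by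
    refine (finite_latQ_norm (ip r r)).subset ?_
    rintro _ ⟨g, hg, rfl⟩
    exact ⟨map_mem_latQ_of_mem_W hg hrQ, ip_map_map_of_mem_W hg r r⟩
  obtain ⟨_, ⟨g, hg, rfl⟩, hmax⟩ := Set.exists_max_image _
    (fun x ↦ (toLex (ip v x, ip r x) : ℝ ×ₗ ℝ)) hfin ⟨_, 1, W.one_mem, rfl⟩
  have hmax' (h) (hh : h ∈ W) := Prod.Lex.toLex_le_toLex.1 (hmax _ ⟨h, hh, rfl⟩)
  dsimp only at hmax'
  refine ⟨g, hg, fun i ↦ ?_, fun j ↦ ?_⟩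
  · obtain ⟨s, hs, hsv⟩ := exists_reflection_mem_W (sroot_mem_Phi i.castSucc)
    have h := hmax' _ (W.mul_mem hs hg)
    have hpair (u : Fin 8 → ℝ) : ip u ((s * g) r) =
        ip u (g r) - ip (g r) (sroot i.castSucc) * ip u (sroot i.castSucc) := by
      rw [LinearEquiv.mul_apply, hsv]
      simp only [ip_eq_dotProduct, dotProduct_sub, dotProduct_smul, smul_eq_mul]
    rw [hpair, hpair] at h
    refine lt_of_le_of_ne ?_ fun h0 ↦ ?_
    · by_contra! hneg
      rcases h with h | ⟨-, h⟩
      · nlinarith [hv i]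
      · nlinarith [hr i.castSucc]
    · have hinv : g⁻¹ ∈ W := W.inv_mem hg
      have hroot : g⁻¹ (sroot i.castSucc) ∈ Phi :=
        ⟨map_mem_latQ_of_mem_W hinv (sroot_mem_Phi _).1,
          (ip_map_map_of_mem_W hinv _ _).trans (ip_sroot_self _)⟩
      refine ip_ne_zero_of_mem_Phi hr hroot ?_
      rw [← ip_map_map_of_mem_W hg, h0, ← LinearEquiv.mul_apply, mul_inv_cancel]
      rfl
  · obtain ⟨s, hs, hsv⟩ := exists_reflection_mem_W (sroot_mem_Phi j)
    have h := hmax' _ (W.mul_mem hg hs)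
    have hpair : ip v ((g * s) r) = ip v (g r) - ip r (sroot j) * ip v (g (sroot j)) := by
      rw [LinearEquiv.mul_apply, hsv, map_sub, map_smul]
      simp only [ip_eq_dotProduct, dotProduct_sub, dotProduct_smul, smul_eq_mul]
    rw [hpair] at h
    have hle : 0 ≤ ip r (sroot j) * ip v (g (sroot j)) := by
      rcases h with h | ⟨h, -⟩ <;> linarith
    exact nonneg_of_mul_nonneg_right hle (hr j)

/-- every Δ⁺(k)-dominant vector in the span of the simple roots lies in
some chamber wC⁽⁰⁾ with wρ strictly Δ⁺(k)-dominant. -/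
theorem e7_dominant_cone_decomposition (sP : Finset (Fin 8 → ℝ))
    (hsP : (sP : Set (Fin 8 → ℝ)) = PhiPos) :
    ∀ v ∈ Submodule.span ℝ (Set.range sroot),
      (∀ i : Fin 6, 0 ≤ ip v (sroot i.castSucc)) →
      ∃ g ∈ W,
        (∀ i : Fin 6, 0 < ip (g ((1/2 : ℝ) • ∑ x ∈ sP, x)) (sroot i.castSucc)) ∧
        ∀ j : Fin 7, 0 ≤ ip v (g (sroot j)) := by
  intro v _ hv
  obtain ⟨g, hg, hpos, hdom⟩ := exists_mem_W_dominant (sum_posRoots_mem_latQ hsP)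
    (fun j ↦ by rw [ip_sum_posRoots hsP]; norm_num) hv
  refine ⟨g, hg, fun i ↦ ?_, hdom⟩
  rw [map_smul, ip_eq_dotProduct, smul_dotProduct, ← ip_eq_dotProduct, smul_eq_mul]
  exact mul_pos (by norm_num) (hpos i)

end E7
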